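/- arXiv:2512.06604 — 8 statements merged into one kernel-verified Lean document; each statement's English description precedes it below -/
import Mathlib

section
/- Define a translation t from ALCι_L concepts to ALCι_G concepts by: t(A) = A for A ∈ N_C, t(¬C) = ¬t(C), t(C ⊓ D) = t(C) ⊓ t(D), t(∃r.C) = ∃r.t(C), and t({ιC}) = t(C) ⊓ (ι t(C).⊤). Then for every ALCι_L concept C, t(C) is an ALCι_G concept and for every interpretation I, (t(C))^I = C^I. In particular, every ALCι_L concept has an equivalent ALCι_G concept. -/
universe u v

namespace DL

/-- ALCι concepts, with atomic concept names and role names both drawn from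
the countably infinite (and disjoint, being distinct sorts) sets `ℕ`. -/
inductive Concept : Type
  | atom : ℕ → Concept
  | neg : Concept → Concept
  | conj : Concept → Concept → Concept
  | ex : ℕ → Concept → Concept
  | iotaL : Concept → Concept
  | iotaG : Concept → Concept → Concept
  deriving DecidableEq

/-- An interpretation with (nonempty) domain `D`. -/
structure Interp (D : Type u) where
  atomI : ℕ → Set D
  roleI : ℕ → Set (D × D)

/-- The extension `C^I` of a concept `C` in the interpretation `I`. -/
def Interp.sem {D : Type u} (I : Interp D) : Concept → Set D
  | .atom A => I.atomI A
  | .neg C => (I.sem C)ᶜ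
  | .conj C D' => I.sem C ∩ I.sem D'
  | .ex r C => {d | ∃ e, (d, e) ∈ I.roleI r ∧ e ∈ I.sem C}
  | .iotaL C => {d | I.sem C = {d}}
  | .iotaG C D' => {_d | ∃ e, I.sem C = {e} ∧ e ∈ I.sem D'}

/-- Concepts not using the global definite description constructor `ιC.D`,
i.e. ALCι_L concepts. -/
def Concept.noG : Concept → Prop
  | .atom _ => True
  | .neg C => C.noG
  | .conj C D => C.noG ∧ D.noG
  | .ex _ C => C.noG
  | .iotaL C => C.noG
  | .iotaG _ _ => False

/-- Concepts not using the local definite description constructor `{ιC}`,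
i.e. ALCι_G concepts. -/
def Concept.noL : Concept → Prop
  | .atom _ => True
  | .neg C => C.noL
  | .conj C D => C.noL ∧ D.noL
  | .ex _ C => C.noL
  | .iotaL _ => False
  | .iotaG C D => C.noL ∧ D.noL

/-- ALC concepts: neither local nor global definite descriptions. -/
def Concept.isALC (C : Concept) : Prop := C.noG ∧ C.noL

/-- `⊤ := ¬(A ⊓ ¬A)` for a fixed atomic concept name `A`. -/
def top (A₀ : ℕ) : Concept := .neg (.conj (.atom A₀) (.neg (.atom A₀)))

/-- The translation `t` from ALCι_L concepts to ALCι_G concepts: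
`t(A) = A`, `t(¬C) = ¬t(C)`, `t(C ⊓ D) = t(C) ⊓ t(D)`, `t(∃r.C) = ∃r.t(C)`,
and `t({ιC}) = t(C) ⊓ (ι t(C).⊤)`.  (On the global definite description
constructor, which does not occur in ALCι_L concepts, it is defined
homomorphically.) -/
def t (A₀ : ℕ) : Concept → Concept
  | .atom A => .atom A
  | .neg C => .neg (t A₀ C)
  | .conj C D => .conj (t A₀ C) (t A₀ D)
  | .ex r C => .ex r (t A₀ C)
  | .iotaL C => .conj (t A₀ C) (.iotaG (t A₀ C) (top A₀))
  | .iotaG C D => .iotaG (t A₀ C) (t A₀ D)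

theorem noL_t (A₀ : ℕ) {C : Concept} (hC : C.noG) : (t A₀ C).noL := by
  induction C with
  | atom A => trivial
  | neg C ih => exact ih hC
  | conj C D ihC ihD => exact ⟨ihC hC.1, ihD hC.2⟩
  | ex r C ih => exact ih hC
  | iotaL C ih => exact ⟨ih hC, ih hC, trivial, trivial⟩
  | iotaG C D _ _ => exact hC.elim

@[simp]
theorem sem_top {D : Type u} (I : Interp D) (A₀ : ℕ) : I.sem (top A₀) = Set.univ := by
  simp [top, Interp.sem]

theorem sem_t (A₀ : ℕ) {D : Type u} (I : Interp D) (C : Concept) :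
    I.sem (t A₀ C) = I.sem C := by
  induction C with
  | atom A => rfl
  | neg C ih => simp only [t, Interp.sem, ih]
  | conj C D ihC ihD => simp only [t, Interp.sem, ihC, ihD]
  | ex r C ih => simp only [t, Interp.sem, ih]
  | iotaL C ih =>
    ext d
    simp only [t, Interp.sem, ih, sem_top, Set.mem_inter_iff, Set.mem_ofPred_eq, Set.mem_univ,
      and_true]
    constructor
    · rintro ⟨hd, e, he⟩
      rw [he] at hd ⊢
      rw [Set.mem_singleton_iff.mp hd]
    · intro h
      exact ⟨h ▸ Set.mem_singleton d, d, h⟩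
  | iotaG C D ihC ihD => simp only [t, Interp.sem, ihC, ihD]

/-- for every ALCι_L concept `C`, `t(C)` is an ALCι_G concept and
`(t(C))^I = C^I` in every interpretation; in particular, every ALCι_L concept
has an equivalent ALCι_G concept. -/
theorem stmt0 (A₀ : ℕ) (C : Concept) (hC : C.noG) :
    (t A₀ C).noL ∧
    (∀ (D : Type u) [Nonempty D] (I : Interp D), I.sem (t A₀ C) = I.sem C) ∧
    (∃ C' : Concept, C'.noL ∧
      ∀ (D : Type u) [Nonempty D] (I : Interp D), I.sem C' = I.sem C) :=
  ⟨noL_t A₀ hC, fun _ _ I => sem_t A₀ I C, t A₀ C, noL_t A₀ hC, fun _ _ I => sem_t A₀ I C⟩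

end DL
end

section
/- Let I and J be finite interpretations (interpretations with finite domains), d ∈ Δ^I and e ∈ Δ^J. If (I,d) ≡_{ALCι_L} (J,e), then (I,d) ∼_{ALCι_L} (J,e); that is, there exists an ALCι_L bisimulation Z between I and J with (d,e) ∈ Z. (This is the instance of the paper's Theorem 3(2) for finite, hence ω-saturated, interpretations.) -/
universe u v

namespace DL

/-- Condition (Atom) for a relation `Z ⊆ Δ^I × Δ^J`. -/
def AtomCond {D : Type u} {E : Type v} (I : Interp D) (J : Interp E) (Z : Set (D × E)) : Prop :=
  ∀ p ∈ Z, ∀ A : ℕ, p.1 ∈ I.atomI A ↔ p.2 ∈ J.atomI A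

/-- Condition (Forth). -/
def ForthCond {D : Type u} {E : Type v} (I : Interp D) (J : Interp E) (Z : Set (D × E)) : Prop :=
  ∀ p ∈ Z, ∀ r : ℕ, ∀ d' : D, (p.1, d') ∈ I.roleI r →
    ∃ e' : E, (p.2, e') ∈ J.roleI r ∧ (d', e') ∈ Z

/-- Condition (Back). -/
def BackCond {D : Type u} {E : Type v} (I : Interp D) (J : Interp E) (Z : Set (D × E)) : Prop :=
  ∀ p ∈ Z, ∀ r : ℕ, ∀ e' : E, (p.2, e') ∈ J.roleI r →
    ∃ d' : D, (p.1, d') ∈ I.roleI r ∧ (d', e') ∈ Z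

/-- `Names(Δ', I)`: the set of ALC concepts whose extension in `I` is a
singleton `{d}` with `d ∈ Δ'`. -/
def Names {D : Type u} (Δ' : Set D) (I : Interp D) : Set Concept :=
  {C | C.isALC ∧ ∃ d ∈ Δ', I.sem C = {d}}

/-- The domain of a relation. -/
def Dom {D : Type u} {E : Type v} (Z : Set (D × E)) : Set D := {d | ∃ e, (d, e) ∈ Z}

/-- The range of a relation. -/
def Rng {D : Type u} {E : Type v} (Z : Set (D × E)) : Set E := {e | ∃ d, (d, e) ∈ Z}

/-- ALCι_L bisimulations between `I` and `J`. -/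
def IsBisimL {D : Type u} {E : Type v} (I : Interp D) (J : Interp E) (Z : Set (D × E)) : Prop :=
  Z = ∅ ∨ (AtomCond I J Z ∧ ForthCond I J Z ∧ BackCond I J Z ∧
    Names (Dom Z) I = Names (Rng Z) J)

/-- ALCι_G bisimulations between `I` and `J`. -/
def IsBisimG {D : Type u} {E : Type v} (I : Interp D) (J : Interp E) (Z : Set (D × E)) : Prop :=
  Z = ∅ ∨ (AtomCond I J Z ∧ ForthCond I J Z ∧ BackCond I J Z ∧
    Names (Set.univ : Set D) I = Names (Set.univ : Set E) J)

/-- ALC bisimulations between `I` and `J`. -/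
def IsBisimALC {D : Type u} {E : Type v} (I : Interp D) (J : Interp E) (Z : Set (D × E)) : Prop :=
  AtomCond I J Z ∧ ForthCond I J Z ∧ BackCond I J Z

/-- The maximal ALC bisimulation between `I` and `J`: the union of all ALC
bisimulations between them. -/
def maxBisimALC {D : Type u} {E : Type v} (I : Interp D) (J : Interp E) : Set (D × E) :=
  ⋃₀ {Z | IsBisimALC I J Z}

/-- `NamedInd(Δ', I)`: the named individuals of `Δ'`. -/
def NamedInd {D : Type u} (Δ' : Set D) (I : Interp D) : Set D :=
  {d ∈ Δ' | ∃ C ∈ Names Δ' I, d ∈ I.sem C}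

/-- A relation `Z` is total over `X × Y`. -/
def TotalOver {D : Type u} {E : Type v} (Z : Set (D × E)) (X : Set D) (Y : Set E) : Prop :=
  (∀ x ∈ X, ∃ y ∈ Y, (x, y) ∈ Z) ∧ (∀ y ∈ Y, ∃ x ∈ X, (x, y) ∈ Z)

/-- `d` and `e` satisfy the same ALCι_L concepts. -/
def EquivL {D : Type u} {E : Type v} (I : Interp D) (J : Interp E) (d : D) (e : E) : Prop :=
  ∀ C : Concept, C.noG → (d ∈ I.sem C ↔ e ∈ J.sem C)

theorem EquivL.symm {D : Type u} {E : Type v} {I : Interp D} {J : Interp E} {d : D} {e : E}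
    (h : EquivL I J d e) : EquivL J I e d :=
  fun C hC => (h C hC).symm

/-- Two inequivalent elements are separated by a concept true at the first one. -/
theorem exists_separating_of_not_equivL {D : Type u} {E : Type v} {I : Interp D} {J : Interp E}
    {d : D} {e : E} (h : ¬ EquivL I J d e) :
    ∃ C : Concept, C.noG ∧ d ∈ I.sem C ∧ e ∉ J.sem C := by
  simp only [EquivL, not_forall] at h
  obtain ⟨C, hC, hne⟩ := h
  by_cases hd : d ∈ I.sem C
  · exact ⟨C, hC, hd, fun he => hne (iff_of_true hd he)⟩
  · exact ⟨.neg C, hC, hd, fun he => hne (iff_of_false hd he)⟩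

/-- An element is separated by a single concept from any finite set of inequivalent elements. -/
theorem exists_separating_of_finite {D : Type u} {E : Type v} (I : Interp D) (J : Interp E)
    (d : D) {S : Set E} (hS : S.Finite) (h : ∀ e ∈ S, ¬ EquivL I J d e) :
    ∃ C : Concept, C.noG ∧ d ∈ I.sem C ∧ ∀ e ∈ S, e ∉ J.sem C := by
  induction S, hS using Set.Finite.induction_on with
  | empty =>
    exact ⟨.neg (.conj (.atom 0) (.neg (.atom 0))), ⟨trivial, trivial⟩,
      fun hd => hd.2 hd.1, fun e he => absurd he (Set.notMem_empty e)⟩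
  | insert _ _ ih =>
    obtain ⟨C, hC, hdC, hSC⟩ := ih fun e he => h e (Set.mem_insert_of_mem _ he)
    obtain ⟨C', hC', hdC', heC'⟩ := exists_separating_of_not_equivL (h _ (Set.mem_insert _ _))
    refine ⟨.conj C' C, ⟨hC', hC⟩, ⟨hdC', hdC⟩, ?_⟩
    rintro e (rfl | he)
    · exact fun hm => heC' hm.1
    · exact fun hm => hSC e he hm.2

theorem EquivL.forth {D : Type u} {E : Type v} [Finite E] {I : Interp D} {J : Interp E}
    {d : D} {e : E} (h : EquivL I J d e) {r : ℕ} {d' : D} (hd' : (d, d') ∈ I.roleI r) :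
    ∃ e' : E, (e, e') ∈ J.roleI r ∧ EquivL I J d' e' := by
  by_contra! hno
  obtain ⟨C, hC, hdC, hSC⟩ :=
    exists_separating_of_finite I J d' (Set.toFinite {e' | (e, e') ∈ J.roleI r}) hno
  obtain ⟨e', he', heC⟩ := (h (.ex r C) hC).1 ⟨d', hd', hdC⟩
  exact hSC e' he' heC

theorem EquivL.sem_eq_singleton {D : Type u} {E : Type v} {I : Interp D} {J : Interp E}
    {d : D} {e : E} (h : EquivL I J d e) {C : Concept} (hC : C.noG) (hd : I.sem C = {d}) :
    J.sem C = {e} :=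
  (h (.iotaL C) hC).1 hd

/-- for finite interpretations, ALCι_L equivalence implies
ALCι_L bisimilarity: if `d` and `e` satisfy the same ALCι_L concepts, then
there is an ALCι_L bisimulation `Z` between `I` and `J` with `(d,e) ∈ Z`. -/
theorem stmt4 {D : Type u} {E : Type v} [Nonempty D] [Nonempty E]
    [Finite D] [Finite E]
    (I : Interp D) (J : Interp E) (d : D) (e : E)
    (h : ∀ C : Concept, C.noG → (d ∈ I.sem C ↔ e ∈ J.sem C)) :
    ∃ Z : Set (D × E), IsBisimL I J Z ∧ (d, e) ∈ Z := by
  refine ⟨{p | EquivL I J p.1 p.2}, Or.inr ⟨?_, ?_, ?_, ?_⟩, h⟩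
  · exact fun p hp A => hp (.atom A) trivial
  · exact fun p hp r d' hd' => EquivL.forth hp hd'
  · intro p hp r e' he'
    obtain ⟨d', hd', hde⟩ := (EquivL.symm hp).forth he'
    exact ⟨d', hd', hde.symm⟩
  · ext C
    constructor
    · rintro ⟨hC, a, ⟨b, hab⟩, ha⟩
      exact ⟨hC, b, ⟨a, hab⟩, EquivL.sem_eq_singleton hab hC.1 ha⟩
    · rintro ⟨hC, b, ⟨a, hab⟩, hb⟩
      exact ⟨hC, a, ⟨b, hab⟩, (EquivL.symm hab).sem_eq_singleton hC.1 hb⟩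

end DL
end

section
/- Fix an atomic concept name A ∈ N_C. Let I be the interpretation with Δ^I = {a,b} (a ≠ b), A'^I = ∅ for every atomic concept name A', and r^I = ∅ for every role name r; let J be the interpretation with Δ^J = {c,d,e} (pairwise distinct), A^J = {e}, A'^J = ∅ for every atomic concept name A' ≠ A, and r^J = ∅ for every role name r. Then Z = {(a,c),(a,d),(b,c),(b,d)} is an ALCι_L bisimulation between I and J; consequently (I,a) ≡_{ALCι_L} (J,c). Moreover, every ALCι_G bisimulation between I and J is empty. -/
universe u v

namespace DL

/-- An extension containing `e` whenever it contains `d ≠ e` is not `{d}`. -/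
theorem ne_singleton_of_mem_iff {D : Type u} {S : Set D} {d e : D} (hne : d ≠ e)
    (h : d ∈ S ↔ e ∈ S) : S ≠ {d} := by
  rintro rfl
  exact hne (h.1 rfl).symm

/-- In an interpretation without role edges, two distinct elements with the same atoms belong to
the same concepts. -/
theorem Interp.mem_sem_iff_of_atoms {D : Type u} {I : Interp D} (hrole : ∀ r, I.roleI r = ∅)
    {d e : D} (hne : d ≠ e) (hatom : ∀ A, d ∈ I.atomI A ↔ e ∈ I.atomI A) (C : Concept) :
    d ∈ I.sem C ↔ e ∈ I.sem C := by
  induction C with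
  | atom A => exact hatom A
  | neg C ih => exact not_congr ih
  | conj C D ihC ihD => exact and_congr ihC ihD
  | ex r C _ => simp [Interp.sem, hrole]
  | iotaL C ih =>
    exact iff_of_false (ne_singleton_of_mem_iff hne ih) (ne_singleton_of_mem_iff hne.symm ih.symm)
  | iotaG C D _ _ => exact Iff.rfl

/-- In interpretations without role edges, elements with the same atoms belong to the same
ALCι_L concepts, provided each of them has a distinct element with the same atoms beside it. -/
theorem Interp.mem_sem_iff_of_noG {D : Type u} {E : Type v} {I : Interp D} {J : Interp E}
    (hI : ∀ r, I.roleI r = ∅) (hJ : ∀ r, J.roleI r = ∅) {d d' : D} {e e' : E}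
    (hd : d ≠ d') (hdatom : ∀ A, d ∈ I.atomI A ↔ d' ∈ I.atomI A)
    (he : e ≠ e') (heatom : ∀ A, e ∈ J.atomI A ↔ e' ∈ J.atomI A)
    (hatom : ∀ A, d ∈ I.atomI A ↔ e ∈ J.atomI A) {C : Concept} (hC : C.noG) :
    d ∈ I.sem C ↔ e ∈ J.sem C := by
  induction C with
  | atom A => exact hatom A
  | neg C ih => exact not_congr (ih hC)
  | conj C D ihC ihD => exact and_congr (ihC hC.1) (ihD hC.2)
  | ex r C _ => simp [Interp.sem, hI, hJ]
  | iotaL C _ =>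
    exact iff_of_false
      (ne_singleton_of_mem_iff hd (Interp.mem_sem_iff_of_atoms hI hd hdatom C))
      (ne_singleton_of_mem_iff he (Interp.mem_sem_iff_of_atoms hJ he heatom C))
  | iotaG C D _ _ => exact hC.elim

/-- Without role edges, no element of `Δ'` is named if each has a distinct element with the same
atoms beside it. -/
theorem Names_eq_empty {D : Type u} {I : Interp D} (hrole : ∀ r, I.roleI r = ∅) {Δ' : Set D}
    (h : ∀ d ∈ Δ', ∃ e, d ≠ e ∧ ∀ A, d ∈ I.atomI A ↔ e ∈ I.atomI A) : Names Δ' I = ∅ := by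
  refine Set.eq_empty_of_forall_notMem ?_
  rintro C ⟨-, d, hd, hC⟩
  obtain ⟨e, hne, hatom⟩ := h d hd
  exact ne_singleton_of_mem_iff hne (Interp.mem_sem_iff_of_atoms hrole hne hatom C) hC

/-- with `I` the two-element interpretation (domain `{a,b} = Fin 2`)
interpreting every atomic concept and every role by `∅`, and `J` the
three-element interpretation (domain `{c,d,e} = Fin 3`) with `A^J = {e}`,
all other atomic concepts and all roles empty, the relation
`Z = {(a,c),(a,d),(b,c),(b,d)}` is an ALCι_L bisimulation between `I` and `J`;
consequently `(I,a) ≡_{ALCι_L} (J,c)`.  Moreover every ALCι_G bisimulation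
between `I` and `J` is empty. -/
theorem stmt7 (A : ℕ)
    (I : Interp (Fin 2)) (hIatom : ∀ A' : ℕ, I.atomI A' = ∅)
    (hIrole : ∀ r : ℕ, I.roleI r = ∅)
    (J : Interp (Fin 3)) (hJA : J.atomI A = {2})
    (hJatom : ∀ A' : ℕ, A' ≠ A → J.atomI A' = ∅)
    (hJrole : ∀ r : ℕ, J.roleI r = ∅)
    (Z : Set (Fin 2 × Fin 3))
    (hZ : Z = {(0, 0), (0, 1), (1, 0), (1, 1)}) :
    IsBisimL I J Z ∧
    (∀ C : Concept, C.noG → ((0 : Fin 2) ∈ I.sem C ↔ (0 : Fin 3) ∈ J.sem C)) ∧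
    (∀ Z' : Set (Fin 2 × Fin 3), IsBisimG I J Z' → Z' = ∅) := by
  have hIatoms : ∀ d e : Fin 2, ∀ A', d ∈ I.atomI A' ↔ e ∈ I.atomI A' := by simp [hIatom]
  have hJnot : ∀ e : Fin 3, e ≠ 2 → ∀ A', e ∉ J.atomI A' := by
    intro e he A'
    by_cases h : A' = A
    · simpa [h, hJA] using he
    · simp [hJatom A' h]
  have hInames : ∀ Δ' : Set (Fin 2), Names Δ' I = ∅ := fun Δ' =>
    Names_eq_empty hIrole fun d _ => (exists_ne d).imp fun e he => ⟨he.symm, hIatoms d e⟩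
  have hZne : ∀ p ∈ Z, p.2 ≠ 2 := by
    subst hZ
    rintro p (rfl | rfl | rfl | rfl) <;> decide
  have hJ01 : ∀ A', (0 : Fin 3) ∈ J.atomI A' ↔ 1 ∈ J.atomI A' := fun A' =>
    iff_of_false (hJnot 0 (by decide) A') (hJnot 1 (by decide) A')
  refine ⟨Or.inr ⟨fun p hp A' => ?_, ?_, ?_, ?_⟩, fun C hC => ?_, ?_⟩
  · exact iff_of_false (by simp [hIatom]) (hJnot p.2 (hZne p hp) A')
  · intro p _ r d' h
    simp [hIrole] at h
  · intro p _ r e' h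
    simp [hJrole] at h
  · rw [hInames, Names_eq_empty hJrole]
    rintro e ⟨d, hde⟩
    have he : e ≠ 2 := hZne _ hde
    have : e = 0 ∨ e = 1 := by omega
    rcases this with rfl | rfl
    · exact ⟨1, by decide, hJ01⟩
    · exact ⟨0, by decide, fun A' => (hJ01 A').symm⟩
  · exact Interp.mem_sem_iff_of_noG hIrole hJrole (d' := 1) (by decide) (hIatoms 0 1)
      (e' := 1) (by decide) hJ01 (fun A' => iff_of_false (by simp [hIatom])
        (hJnot 0 (by decide) A')) hC
  · rintro Z' (h | ⟨-, -, -, h⟩)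
    · exact h
    · have hA : Concept.atom A ∈ Names Set.univ J := ⟨⟨trivial, trivial⟩, 2, trivial, hJA⟩
      rw [← h, hInames] at hA
      exact hA.elim

end DL
end

section
/- Let I be a finite interpretation and let Z_I be the maximal ALC bisimulation between I and itself. Then for every d ∈ Δ^I: d ∈ NamedInd(Δ^I, I) (i.e., C^I = {d} for some ALC concept C) if and only if there is no e ∈ Δ^I with e ≠ d and (d,e) ∈ Z_I. -/
universe u v

namespace DL

theorem Interp.mem_sem_iff_of_isBisimALC {D : Type u} {E : Type v} {I : Interp D} {J : Interp E}
    {Z : Set (D × E)} (hZ : IsBisimALC I J Z) (C : Concept) (hG : C.noG) (hL : C.noL) :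
    ∀ {x : D} {y : E}, (x, y) ∈ Z → (x ∈ I.sem C ↔ y ∈ J.sem C) := by
  induction C with
  | atom A => exact fun h => hZ.1 _ h A
  | neg C ih => exact fun h => not_congr (ih hG hL h)
  | conj C C' ih ih' => exact fun h => and_congr (ih hG.1 hL.1 h) (ih' hG.2 hL.2 h)
  | ex r C ih =>
    intro x y h
    constructor
    · rintro ⟨x', hr, hx'⟩
      obtain ⟨y', hr', hz⟩ := hZ.2.1 _ h r x' hr
      exact ⟨y', hr', (ih hG hL hz).1 hx'⟩
    · rintro ⟨y', hr, hy'⟩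
      obtain ⟨x', hr', hz⟩ := hZ.2.2 _ h r y' hr
      exact ⟨x', hr', (ih hG hL hz).2 hy'⟩
  | iotaL C ih => exact hL.elim
  | iotaG C C' ih ih' => exact hG.elim

/-- The pairs of individuals that satisfy the same ALC concepts. -/
def equivALC {D : Type u} {E : Type v} (I : Interp D) (J : Interp E) : Set (D × E) :=
  {p | ∀ C : Concept, C.isALC → (p.1 ∈ I.sem C ↔ p.2 ∈ J.sem C)}

theorem exists_isALC_separating {D : Type u} {E : Type v} {I : Interp D} {J : Interp E}
    {x : D} {y : E} (h : (x, y) ∉ equivALC I J) :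
    ∃ C : Concept, C.isALC ∧ x ∈ I.sem C ∧ y ∉ J.sem C := by
  simp only [equivALC, Set.mem_ofPred_eq, not_forall] at h
  obtain ⟨C, hC, h⟩ := h
  by_cases hx : x ∈ I.sem C
  · exact ⟨C, hC, hx, fun hy => h (iff_of_true hx hy)⟩
  · exact ⟨.neg C, hC, hx, fun hy => h (iff_of_false hx hy)⟩

theorem exists_isALC_separating_finite {D : Type u} {E : Type v} {I : Interp D} {J : Interp E}
    {x : D} {S : Set E} (hS : S.Finite) (h : ∀ y ∈ S, (x, y) ∉ equivALC I J) :
    ∃ C : Concept, C.isALC ∧ x ∈ I.sem C ∧ ∀ y ∈ S, y ∉ J.sem C := by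
  induction S, hS using Set.Finite.induction_on with
  | empty =>
    exact ⟨.neg (.conj (.atom 0) (.neg (.atom 0))), ⟨⟨trivial, trivial⟩, trivial, trivial⟩,
      fun hx => hx.2 hx.1, by simp⟩
  | @insert a S _ _ ih =>
    obtain ⟨C, hC, hx, hy⟩ := ih fun y hy => h y (Set.mem_insert_of_mem a hy)
    obtain ⟨C', hC', hx', hy'⟩ := exists_isALC_separating (h a (Set.mem_insert a S))
    refine ⟨.conj C C', ⟨⟨hC.1, hC'.1⟩, hC.2, hC'.2⟩, ⟨hx, hx'⟩, ?_⟩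
    rintro y (rfl | hyS) hmem
    · exact hy' hmem.2
    · exact hy y hyS hmem.1

theorem forthCond_equivALC {D : Type u} {E : Type v} [Finite E] (I : Interp D) (J : Interp E) :
    ForthCond I J (equivALC I J) := by
  rintro ⟨x, y⟩ h r x' hr
  by_contra! hne
  obtain ⟨C, hC, hx', hy'⟩ :=
    exists_isALC_separating_finite (Set.toFinite {y' | (y, y') ∈ J.roleI r}) hne
  obtain ⟨y', hr', hmem⟩ := (h (.ex r C) hC).1 ⟨x', hr, hx'⟩
  exact hy' y' hr' hmem

theorem equivALC_swap {D : Type u} {E : Type v} {I : Interp D} {J : Interp E} {x : D} {y : E}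
    (h : (x, y) ∈ equivALC I J) : (y, x) ∈ equivALC J I :=
  fun C hC => (h C hC).symm

theorem isBisimALC_equivALC {D : Type u} {E : Type v} [Finite D] [Finite E]
    (I : Interp D) (J : Interp E) : IsBisimALC I J (equivALC I J) := by
  refine ⟨fun p hp A => hp (.atom A) ⟨trivial, trivial⟩, forthCond_equivALC I J, ?_⟩
  rintro ⟨x, y⟩ h r y' hr
  obtain ⟨x', hr', h'⟩ := forthCond_equivALC J I _ (equivALC_swap h) r y' hr
  exact ⟨x', hr', equivALC_swap h'⟩

/-- On finite interpretations, bisimilarity coincides with indistinguishability by concepts. -/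
theorem maxBisimALC_eq_equivALC {D : Type u} {E : Type v} [Finite D] [Finite E]
    (I : Interp D) (J : Interp E) : maxBisimALC I J = equivALC I J := by
  apply Set.Subset.antisymm
  · rintro ⟨x, y⟩ ⟨Z, hZ, hxy⟩ C hC
    exact Interp.mem_sem_iff_of_isBisimALC hZ C hC.1 hC.2 hxy
  · exact Set.subset_sUnion_of_mem (isBisimALC_equivALC I J)

/-- for a finite interpretation `I` with `Z_I` the maximal ALC
bisimulation between `I` and itself, an individual `d` is named (i.e.
`C^I = {d}` for some ALC concept `C`) iff no `e ≠ d` satisfies `(d,e) ∈ Z_I`. -/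
theorem stmt9 {D : Type u} [Nonempty D] [Finite D] (I : Interp D) (d : D) :
    d ∈ NamedInd (Set.univ : Set D) I ↔
      ¬ ∃ e : D, e ≠ d ∧ (d, e) ∈ maxBisimALC I I := by
  rw [maxBisimALC_eq_equivALC]
  constructor
  · rintro ⟨-, C, ⟨hC, d', -, hd'⟩, hd⟩ ⟨e, hne, he⟩
    have hmem : e ∈ I.sem C := (he C hC).1 hd
    rw [hd', Set.mem_singleton_iff] at hd hmem
    exact hne (hmem.trans hd.symm)
  · intro h
    obtain ⟨C, hC, hd, hne⟩ := exists_isALC_separating_finite (Set.toFinite {e | e ≠ d})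
      (fun e he h' => h ⟨e, he, h'⟩)
    refine ⟨trivial, C, ⟨hC, d, trivial, ?_⟩, hd⟩
    exact Set.eq_singleton_iff_unique_mem.2
      ⟨hd, fun e he => by_contra fun hed => hne e hed he⟩

end DL
end

section
/- For finite interpretations I and J, the union of all ALCι_L bisimulations between I and J is itself an ALCι_L bisimulation between I and J; in particular, a maximal ALCι_L bisimulation between finite interpretations exists. -/
universe u v

namespace DL

theorem IsBisimL.conditions {D : Type u} {E : Type v} {I : Interp D} {J : Interp E}
    {Z : Set (D × E)} (h : IsBisimL I J Z) :
    AtomCond I J Z ∧ ForthCond I J Z ∧ BackCond I J Z ∧ Names (Dom Z) I = Names (Rng Z) J := by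
  rcases h with rfl | h
  · simp [AtomCond, ForthCond, BackCond, Names, Dom, Rng]
  · exact h

/-- A union of ALCι_L bisimulations is an ALCι_L bisimulation. -/
theorem IsBisimL.sUnion {D : Type u} {E : Type v} {I : Interp D} {J : Interp E}
    {S : Set (Set (D × E))} (hS : ∀ Z ∈ S, IsBisimL I J Z) : IsBisimL I J (⋃₀ S) := by
  refine Or.inr ⟨?_, ?_, ?_, ?_⟩
  · rintro p ⟨Z, hZ, hp⟩
    exact (hS Z hZ).conditions.1 p hp
  · rintro p ⟨Z, hZ, hp⟩ r d' hd
    obtain ⟨e', he, hde⟩ := (hS Z hZ).conditions.2.1 p hp r d' hd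
    exact ⟨e', he, Z, hZ, hde⟩
  · rintro p ⟨Z, hZ, hp⟩ r e' he
    obtain ⟨d', hd, hde⟩ := (hS Z hZ).conditions.2.2.1 p hp r e' he
    exact ⟨d', hd, Z, hZ, hde⟩
  · ext C
    constructor
    · rintro ⟨hC, d, ⟨e, Z, hZ, hde⟩, hd⟩
      have hmem : C ∈ Names (Dom Z) I := ⟨hC, d, ⟨e, hde⟩, hd⟩
      rw [(hS Z hZ).conditions.2.2.2] at hmem
      obtain ⟨-, e', ⟨d', hde'⟩, he'⟩ := hmem
      exact ⟨hC, e', ⟨d', Z, hZ, hde'⟩, he'⟩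
    · rintro ⟨hC, e, ⟨d, Z, hZ, hde⟩, he⟩
      have hmem : C ∈ Names (Rng Z) J := ⟨hC, e, ⟨d, hde⟩, he⟩
      rw [← (hS Z hZ).conditions.2.2.2] at hmem
      obtain ⟨-, d', ⟨e', hde'⟩, hd'⟩ := hmem
      exact ⟨hC, d', ⟨e', Z, hZ, hde'⟩, hd'⟩

/-- for finite interpretations, the union of all ALCι_L
bisimulations between `I` and `J` is itself an ALCι_L bisimulation; in
particular a maximal ALCι_L bisimulation exists. -/
theorem stmt12 {D : Type u} {E : Type v} [Nonempty D] [Nonempty E]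
    [Finite D] [Finite E]
    (I : Interp D) (J : Interp E) :
    IsBisimL I J (⋃₀ {Z : Set (D × E) | IsBisimL I J Z}) ∧
    ∃ W : Set (D × E), IsBisimL I J W ∧
      ∀ Z : Set (D × E), IsBisimL I J Z → Z ⊆ W := by
  have h : IsBisimL I J (⋃₀ {Z : Set (D × E) | IsBisimL I J Z}) := IsBisimL.sUnion fun _ hZ => hZ
  exact ⟨h, _, h, fun _ hZ => Set.subset_sUnion_of_mem hZ⟩

end DL
end

section
/- If an ALCι concept C is satisfiable, then C is satisfied in an interpretation whose domain contains at most 2^{4·|C|} elements, where |C| is the number of symbols of C not counting parentheses (each occurrence of an atomic concept name, role name, ¬, ⊓, ∃, ., ι, {, or } counts as one symbol). -/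
universe u v

namespace DL

/-- `|C|`: the number of symbols of `C`, not counting parentheses.  Each
occurrence of an atomic concept name, role name, `¬`, `⊓`, `∃`, `.`, `ι`,
`{` or `}` counts as one symbol. -/
def size : Concept → ℕ
  | .atom _ => 1
  | .neg C => size C + 1
  | .conj C D => size C + size D + 1
  | .ex _ C => size C + 3
  | .iotaL C => size C + 3
  | .iotaG C D => size C + size D + 2

/-- The finite set of subconcepts of a concept. -/
def Concept.sub : Concept → Finset Concept
  | .atom A => {.atom A}
  | .neg C => insert (.neg C) C.sub
  | .conj C D => insert (.conj C D) (C.sub ∪ D.sub)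
  | .ex r C => insert (.ex r C) C.sub
  | .iotaL C => insert (.iotaL C) C.sub
  | .iotaG C D => insert (.iotaG C D) (C.sub ∪ D.sub)

theorem Concept.mem_sub_self (C : Concept) : C ∈ C.sub := by
  cases C <;> simp [Concept.sub]

theorem Concept.card_sub_le (C : Concept) : C.sub.card ≤ size C := by
  induction C with
  | atom A => simp [Concept.sub, size]
  | neg C ih | ex r C ih | iotaL C ih =>
    exact (Finset.card_insert_le _ _).trans (by simp only [size]; omega)
  | conj C D ihC ihD | iotaG C D ihC ihD =>
    have := Finset.card_union_le C.sub D.sub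
    exact (Finset.card_insert_le _ _).trans (by simp only [size]; omega)

theorem size_pos (C : Concept) : 0 < size C := by
  cases C <;> simp [size]

/-- Up to two representatives of every fibre of a map into a finite type: any two distinct points
are matched by distinct representatives of their fibres. -/
theorem exists_finite_pair_representatives {α : Type u} {β : Type v} [Nonempty α] [Finite β]
    (f : α → β) :
    ∃ S : Set α, S.Finite ∧ S.ncard ≤ 2 * Nat.card β ∧
      ∀ d e, ∃ x ∈ S, ∃ y ∈ S, f x = f d ∧ f y = f e ∧ (d ≠ e → x ≠ y) := by
  classical
  let r : β → α := Function.invFun f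
  have hr (d : α) : f (r (f d)) = f d := Function.invFun_eq ⟨d, rfl⟩
  let s : β → α := fun b => if h : ∃ e, e ≠ r b ∧ f e = b then h.choose else r b
  have hs {d : α} (h : d ≠ r (f d)) : s (f d) ≠ r (f d) ∧ f (s (f d)) = f d := by
    have h' : ∃ e, e ≠ r (f d) ∧ f e = f d := ⟨d, h, rfl⟩
    simp only [s, dif_pos h']
    exact h'.choose_spec
  refine ⟨Set.range r ∪ Set.range s, (Set.finite_range r).union (Set.finite_range s), ?_, ?_⟩
  · have hcard (g : β → α) : (Set.range g).ncard ≤ Nat.card β := by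
      rw [← Set.image_univ, ← Set.ncard_univ β]
      exact Set.ncard_image_le
    have := Set.ncard_union_le (Set.range r) (Set.range s)
    have := hcard r
    have := hcard s
    omega
  · intro d e
    have hrS (b : β) : r b ∈ Set.range r ∪ Set.range s := .inl ⟨b, rfl⟩
    have hsS (b : β) : s b ∈ Set.range r ∪ Set.range s := .inr ⟨b, rfl⟩
    by_cases hde : f d = f e
    · by_cases hd : d = r (f d)
      · by_cases he : e = r (f e)
        · exact ⟨_, hrS (f d), _, hrS (f e), hr d, hr e,
            fun hne => absurd (hd.trans (hde ▸ he.symm)) hne⟩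
        · exact ⟨_, hrS (f d), _, hsS (f e), hr d, (hs he).2,
            fun _ => hde ▸ (hs he).1.symm⟩
      · exact ⟨_, hsS (f d), _, hrS (f e), (hs hd).2, hr e, fun _ => hde ▸ (hs hd).1⟩
    · exact ⟨_, hrS (f d), _, hrS (f e), hr d, hr e,
        fun _ hxy => hde (by rw [← hr d, hxy, hr e])⟩

/-- The set of members of `Γ` that hold at a point. -/
def Interp.typeOf {D : Type u} (I : Interp D) (Γ : Finset Concept) (d : D) : Set Γ :=
  {C | d ∈ I.sem C}

theorem Interp.mem_sem_iff_of_typeOf_eq {D : Type u} {I : Interp D} {Γ : Finset Concept} {d e : D}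
    (h : I.typeOf Γ d = I.typeOf Γ e) {C : Concept} (hC : C ∈ Γ) : d ∈ I.sem C ↔ e ∈ I.sem C :=
  Set.ext_iff.mp h ⟨C, hC⟩

/-- The filtration of `I` through `Γ` along a map `p`. -/
def Interp.filtration {D : Type u} {W : Type v} (I : Interp D) (Γ : Finset Concept) (p : W → D) :
    Interp W where
  atomI A := p ⁻¹' I.atomI A
  roleI r := {w | ∃ e, I.typeOf Γ (p w.2) = I.typeOf Γ e ∧ (p w.1, e) ∈ I.roleI r}

theorem preimage_eq_singleton_iff {α : Type u} {W : Type v} {p : W → α}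
    (hp : Function.Injective p) {s : Set α}
    (hs : ∀ d ∈ s, ∀ e ∈ s, ∃ x y, p x ∈ s ∧ p y ∈ s ∧ (d ≠ e → x ≠ y)) (w : W) :
    p ⁻¹' s = {w} ↔ s = {p w} := by
  constructor
  · intro h
    have hw : p w ∈ s := by
      have : w ∈ p ⁻¹' s := by rw [h]; rfl
      exact this
    refine Set.eq_singleton_iff_unique_mem.mpr ⟨hw, fun d hd => ?_⟩
    by_contra hne
    obtain ⟨x, y, hx, hy, hxy⟩ := hs d hd _ hw
    have hx' : x ∈ p ⁻¹' s := hx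
    have hy' : y ∈ p ⁻¹' s := hy
    rw [h] at hx' hy'
    exact hxy hne (hx'.trans hy'.symm)
  · rintro rfl
    rw [← Set.image_singleton, hp.preimage_image]

/-- The filtration lemma: if `p` is injective and distinct points of `D` are matched by distinct
points of `W`, then truth of the members of `Γ` is preserved. -/
theorem Interp.sem_filtration {D : Type u} {W : Type v} (I : Interp D) {Γ : Finset Concept}
    {p : W → D} (hp : Function.Injective p)
    (hpair : ∀ d e, ∃ x y, I.typeOf Γ (p x) = I.typeOf Γ d ∧ I.typeOf Γ (p y) = I.typeOf Γ e ∧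
      (d ≠ e → x ≠ y))
    (C : Concept) (hC : C.sub ⊆ Γ) : (I.filtration Γ p).sem C = p ⁻¹' I.sem C := by
  have hsingle {C : Concept} (hC : C ∈ Γ) (w : W) :
      p ⁻¹' I.sem C = {w} ↔ I.sem C = {p w} := by
    refine preimage_eq_singleton_iff hp (fun d hd e he => ?_) w
    obtain ⟨x, y, hx, hy, hxy⟩ := hpair d e
    exact ⟨x, y, (mem_sem_iff_of_typeOf_eq hx hC).mpr hd,
      (mem_sem_iff_of_typeOf_eq hy hC).mpr he, hxy⟩
  induction C with
  | atom A => rfl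
  | neg C ih =>
    simp only [Concept.sub, Finset.insert_subset_iff] at hC
    simp only [Interp.sem, ih hC.2, Set.preimage_compl]
  | conj C D ihC ihD =>
    simp only [Concept.sub, Finset.insert_subset_iff, Finset.union_subset_iff] at hC
    simp only [Interp.sem, ihC hC.2.1, ihD hC.2.2, Set.preimage_inter]
  | ex r C ih =>
    simp only [Concept.sub, Finset.insert_subset_iff] at hC
    have hCΓ := hC.2 C.mem_sub_self
    ext w
    simp only [Interp.sem, ih hC.2, Set.mem_ofPred_eq, Set.mem_preimage]
    constructor
    · rintro ⟨v, ⟨e, hve, hwe⟩, hv⟩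
      exact ⟨e, hwe, (mem_sem_iff_of_typeOf_eq hve hCΓ).mp hv⟩
    · rintro ⟨e, hwe, he⟩
      obtain ⟨v, -, hv, -⟩ := hpair e e
      exact ⟨v, ⟨e, hv, hwe⟩, (mem_sem_iff_of_typeOf_eq hv hCΓ).mpr he⟩
  | iotaL C ih =>
    simp only [Concept.sub, Finset.insert_subset_iff] at hC
    ext w
    simp only [Interp.sem, ih hC.2, Set.mem_ofPred_eq, Set.mem_preimage]
    exact hsingle (hC.2 C.mem_sub_self) w
  | iotaG C D ihC ihD =>
    simp only [Concept.sub, Finset.insert_subset_iff, Finset.union_subset_iff] at hC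
    have hCΓ := hC.2.1 C.mem_sub_self
    ext w
    simp only [Interp.sem, ihC hC.2.1, ihD hC.2.2, Set.mem_ofPred_eq, Set.mem_preimage,
      hsingle hCΓ]
    constructor
    · rintro ⟨v, hv, hvD⟩
      exact ⟨p v, hv, hvD⟩
    · rintro ⟨e, he, heD⟩
      obtain ⟨v, -, hv, -⟩ := hpair e e
      have hve : p v ∈ I.sem C := (mem_sem_iff_of_typeOf_eq hv hCΓ).mpr (by rw [he]; rfl)
      rw [he] at hve
      obtain rfl : p v = e := hve
      exact ⟨v, he, heD⟩

/-- a satisfiable ALCι concept is satisfied in an interpretation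
whose domain has at most `2 ^ (4 * |C|)` elements. -/
theorem stmt13 (C : Concept)
    (h : ∃ (D : Type u) (_ : Nonempty D) (I : Interp D), (I.sem C).Nonempty) :
    ∃ (D : Type) (_ : Nonempty D) (_ : Finite D) (I : Interp D),
      Nat.card D ≤ 2 ^ (4 * size C) ∧ (I.sem C).Nonempty := by
  obtain ⟨D, _, I, d, hd⟩ := h
  obtain ⟨S, hfin, hcard, hS⟩ := exists_finite_pair_representatives (I.typeOf C.sub)
  have : Finite S := hfin
  let p : Fin (Nat.card S) → D := fun i => ((Finite.equivFin S).symm i : S)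
  have hp : Function.Injective p :=
    Subtype.val_injective.comp (Finite.equivFin S).symm.injective
  have hpS {x : D} (hx : x ∈ S) : p (Finite.equivFin S ⟨x, hx⟩) = x :=
    congrArg Subtype.val ((Finite.equivFin S).symm_apply_apply ⟨x, hx⟩)
  have hpair : ∀ d e, ∃ x y, I.typeOf C.sub (p x) = I.typeOf C.sub d ∧
      I.typeOf C.sub (p y) = I.typeOf C.sub e ∧ (d ≠ e → x ≠ y) := by
    intro d e
    obtain ⟨x, hx, y, hy, hxd, hye, hxy⟩ := hS d e
    refine ⟨Finite.equivFin S ⟨x, hx⟩, Finite.equivFin S ⟨y, hy⟩, ?_, ?_, fun hne heq => ?_⟩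
    · rw [hpS, hxd]
    · rw [hpS, hye]
    · exact hxy hne (by rw [← hpS hx, heq, hpS hy])
  obtain ⟨w, -, hw, -⟩ := hpair d d
  refine ⟨Fin (Nat.card S), ⟨w⟩, inferInstance, I.filtration C.sub p, ?_, w, ?_⟩
  · calc Nat.card (Fin (Nat.card S)) = S.ncard := by rw [Nat.card_fin, Nat.card_coe_set_eq]
      _ ≤ 2 * Nat.card (Set C.sub) := hcard
      _ = 2 ^ (C.sub.card + 1) := by
        rw [Nat.card_eq_fintype_card, Fintype.card_set, Fintype.card_coe, pow_succ']
      _ ≤ 2 ^ (4 * size C) := by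
        have := C.card_sub_le
        have := size_pos C
        exact Nat.pow_le_pow_right (by norm_num) (by omega)
  · rw [I.sem_filtration hp hpair C subset_rfl]
    exact (Interp.mem_sem_iff_of_typeOf_eq hw C.mem_sub_self).mpr hd

end DL
end

section
/- Let C be an ALC concept and T a finite set of pairs (D,E) of ALC concepts (a TBox of concept inclusions D ⊑ E). For each (D,E) ∈ T, let A_{D⊑E} be a fresh atomic concept name, the fresh names pairwise distinct and not occurring in C or in any concept of T. Define the ALCι_L concept C' := C ⊓ ⨅_{(D,E)∈T} ((¬D ⊔ E) ⊓ {ι(¬(¬D ⊔ E) ⊔ A_{D⊑E})}). Then C' is satisfiable if and only if C is satisfiable with respect to T, i.e., there is an interpretation I with C^I ≠ ∅ and D^I ⊆ E^I for every (D,E) ∈ T. -/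
universe u v

namespace DL

/-- `C ⊔ D := ¬(¬C ⊓ ¬D)`. -/
def disj (C D : Concept) : Concept := .neg (.conj (.neg C) (.neg D))

/-- `⨅`: the conjunction of a finite family of concepts. -/
def bigConj : List Concept → Concept
  | [] => top 0
  | C :: l => .conj C (bigConj l)

/-- The atomic concept names occurring in a concept. -/
def conceptNames : Concept → Finset ℕ
  | .atom A => {A}
  | .neg C => conceptNames C
  | .conj C D => conceptNames C ∪ conceptNames D
  | .ex _ C => conceptNames C
  | .iotaL C => conceptNames C
  | .iotaG C D => conceptNames C ∪ conceptNames D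

theorem Interp.mem_sem_disj {D : Type u} (I : Interp D) (C E : Concept) (d : D) :
    d ∈ I.sem (disj C E) ↔ d ∈ I.sem C ∨ d ∈ I.sem E := by
  simp only [disj, Interp.sem, Set.mem_compl_iff, Set.mem_inter_iff]
  tauto

theorem Interp.mem_sem_bigConj {D : Type u} (I : Interp D) (l : List Concept) (d : D) :
    d ∈ I.sem (bigConj l) ↔ ∀ C ∈ l, d ∈ I.sem C := by
  induction l with
  | nil => simp [bigConj, top, Interp.sem]
  | cons C l ih => simp [bigConj, Interp.sem, ih]

/-- The extension of a concept depends only on the atomic concept names occurring in it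
and on the role names. -/
theorem Interp.sem_congr {D : Type u} {I J : Interp D} (hrole : I.roleI = J.roleI)
    (C : Concept) (h : ∀ a ∈ conceptNames C, I.atomI a = J.atomI a) : I.sem C = J.sem C := by
  induction C with
  | atom a => exact h a (by simp [conceptNames])
  | neg C ih => simp only [Interp.sem, ih h]
  | ex r C ih => simp only [Interp.sem, ih h, hrole]
  | iotaL C ih => simp only [Interp.sem, ih h]
  | conj C E ihC ihE =>
    simp only [Interp.sem, ihC fun a ha => h a (Finset.mem_union_left _ ha),
      ihE fun a ha => h a (Finset.mem_union_right _ ha)]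
  | iotaG C E ihC ihE =>
    simp only [Interp.sem, ihC fun a ha => h a (Finset.mem_union_left _ ha),
      ihE fun a ha => h a (Finset.mem_union_right _ ha)]

/-- The description of the violators of `E` together with `a` denotes `d`, and `d` satisfies `E`,
exactly when `E` holds everywhere and `a` denotes `d`. -/
theorem Interp.mem_sem_conj_iotaL {D : Type u} (I : Interp D) (E : Concept) (a : ℕ) (d : D) :
    d ∈ I.sem (.conj E (.iotaL (disj (.neg E) (.atom a)))) ↔
      (∀ x, x ∈ I.sem E) ∧ I.atomI a = {d} := by
  simp only [Interp.sem, Set.mem_inter_iff, Set.mem_ofPred_eq, Set.ext_iff, I.mem_sem_disj,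
    Set.mem_compl_iff, Set.mem_singleton_iff]
  constructor
  · rintro ⟨hd, h⟩
    have hE : ∀ x, x ∈ I.sem E := fun x => by
      by_contra hx
      exact hx ((h x).1 (Or.inl hx) ▸ hd)
    exact ⟨hE, fun x => by simpa [hE x] using h x⟩
  · rintro ⟨hE, h⟩
    exact ⟨hE d, fun x => by simpa [hE x] using h x⟩

/-- the ALCι_L concept
`C' := C ⊓ ⨅_{(D,E)∈T} ((¬D ⊔ E) ⊓ {ι(¬(¬D ⊔ E) ⊔ A_{D⊑E})})`
is satisfiable iff the ALC concept `C` is satisfiable w.r.t. the TBox `T`,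
where the `A_{D⊑E}` are pairwise distinct fresh atomic concept names. -/
theorem stmt14 (C : Concept) (T : Finset (Concept × Concept))
    (hC : C.isALC) (hT : ∀ p ∈ T, p.1.isALC ∧ p.2.isALC)
    (A : Concept × Concept → ℕ)
    (hinj : ∀ p ∈ T, ∀ q ∈ T, A p = A q → p = q)
    (hfreshC : ∀ p ∈ T, A p ∉ conceptNames C)
    (hfreshT : ∀ p ∈ T, ∀ q ∈ T, A p ∉ conceptNames q.1 ∪ conceptNames q.2)
    (C' : Concept)
    (hC' : C' = .conj C (bigConj (T.toList.map fun p =>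
      .conj (disj (.neg p.1) p.2)
        (.iotaL (disj (.neg (disj (.neg p.1) p.2)) (.atom (A p))))))) :
    (∃ (D : Type u) (_ : Nonempty D) (I : Interp D), (I.sem C').Nonempty) ↔
    (∃ (D : Type u) (_ : Nonempty D) (I : Interp D),
      (I.sem C).Nonempty ∧ ∀ p ∈ T, I.sem p.1 ⊆ I.sem p.2) := by
  subst hC'
  have key : ∀ (D : Type u) (I : Interp D) (d : D), d ∈ I.sem (.conj C (bigConj
      (T.toList.map fun p => .conj (disj (.neg p.1) p.2)
        (.iotaL (disj (.neg (disj (.neg p.1) p.2)) (.atom (A p))))))) ↔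
      d ∈ I.sem C ∧ ∀ p ∈ T, I.sem p.1 ⊆ I.sem p.2 ∧ I.atomI (A p) = {d} := by
    intro D I d
    rw [Interp.sem, Set.mem_inter_iff, I.mem_sem_bigConj]
    simp only [List.forall_mem_map, Finset.mem_toList, I.mem_sem_conj_iotaL, I.mem_sem_disj]
    simp only [Interp.sem, Set.mem_compl_iff, ← imp_iff_not_or, Set.subset_def]
  constructor
  · rintro ⟨D, hD, I, d, hd⟩
    obtain ⟨hdC, h⟩ := (key D I d).1 hd
    exact ⟨D, hD, I, ⟨d, hdC⟩, fun p hp => (h p hp).1⟩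
  · classical
    rintro ⟨D, hD, I, ⟨d, hd⟩, h⟩
    let J : Interp D := ⟨fun a => if ∃ p ∈ T, A p = a then {d} else I.atomI a, I.roleI⟩
    have hJ : ∀ E : Concept, (∀ p ∈ T, A p ∉ conceptNames E) → J.sem E = I.sem E := by
      intro E hE
      refine Interp.sem_congr (I := J) (J := I) rfl E fun a ha => if_neg ?_
      rintro ⟨p, hp, rfl⟩
      exact hE p hp ha
    refine ⟨D, hD, J, d, (key D J d).2 ⟨by rwa [hJ C hfreshC], fun p hp => ⟨?_, ?_⟩⟩⟩
    · rw [hJ p.1 fun q hq hm => hfreshT q hq p hp (Finset.mem_union_left _ hm),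
        hJ p.2 fun q hq hm => hfreshT q hq p hp (Finset.mem_union_right _ hm)]
      exact h p hp
    · exact if_pos ⟨p, hp, rfl⟩

end DL
end

section
/- Let L be the first-order language (with equality) having a unary relation symbol P_A for each atomic concept name A ∈ N_C and a binary relation symbol R_r for each role name r ∈ N_R, and regard every interpretation I as an L-structure on Δ^I with P_A interpreted as A^I and R_r as r^I (equality interpreted as actual equality). Define the standard translation ST_x from ALCι concepts to L-formulas with at most the free variable x (with ST_y defined symmetrically, swapping the roles of the variables x and y) by: ST_x(A) = P_A(x); ST_x(¬C) = ¬ST_x(C); ST_x(C ⊓ D) = ST_x(C) ∧ ST_x(D); ST_x(∃r.C) = ∃y (R_r(x,y) ∧ ST_y(C)); ST_x({ιC}) = ST_x(C) ∧ ∀y (ST_y(C) → x = y); ST_x(ιC.D) = ∃y (ST_y(C) ∧ ∀x (ST_x(C) → x = y) ∧ ST_y(D)). Then for every interpretation I, every d ∈ Δ^I, and every ALCι concept C: d ∈ C^I if and only if I ⊨ ST_x(C)[x ↦ d]. -/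
universe u

open FirstOrder FirstOrder.Language

namespace DL

/-- The relation symbols of the first-order language `L`: a unary relation
symbol `P_A` for each atomic concept name `A ∈ ℕ` and a binary relation
symbol `R_r` for each role name `r ∈ ℕ`. -/
inductive DDRel : ℕ → Type
  | atom : ℕ → DDRel 1
  | role : ℕ → DDRel 2

/-- The first-order language `L` (no function symbols; equality is the
built-in equality of bounded formulas). -/
def ddLang : Language := ⟨fun _ => Empty, DDRel⟩

/-- Every interpretation `I` is regarded as an `L`-structure on its domain,
with `P_A` interpreted as `A^I` and `R_r` as `r^I`. -/
def Interp.toStructure {D : Type u} (I : Interp D) : ddLang.Structure D where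
  funMap := fun f _ => f.elim
  RelMap := fun {n} (R : DDRel n) =>
    match R with
    | .atom A => fun args => args 0 ∈ I.atomI A
    | .role r => fun args => (args 0, args 1) ∈ I.roleI r

/-- The standard translation `ST_x` of ALCι concepts into `L`-formulas with
(at most) one free variable `x`, which is here represented as the de Bruijn
variable of a bounded formula in context `1`.  The clauses are:
`ST_x(A) = P_A(x)`; `ST_x(¬C) = ¬ST_x(C)`; `ST_x(C ⊓ D) = ST_x(C) ∧ ST_x(D)`;
`ST_x(∃r.C) = ∃y (R_r(x,y) ∧ ST_y(C))`;
`ST_x({ιC}) = ST_x(C) ∧ ∀y (ST_y(C) → x = y)`;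
`ST_x(ιC.D) = ∃y (ST_y(C) ∧ ∀x (ST_x(C) → x = y) ∧ ST_y(D))`,
where the renaming of the free variable `x` into `y` (i.e. `ST_y`) is
realized by `liftAt`. -/
def ST : Concept → ddLang.BoundedFormula Empty 1
  | .atom A => BoundedFormula.rel (DDRel.atom A) ![&0]
  | .neg C => ∼(ST C)
  | .conj C D => ST C ⊓ ST D
  | .ex r C =>
      (BoundedFormula.rel (DDRel.role r) ![&0, &1] ⊓ (ST C).liftAt 1 0).ex
  | .iotaL C => ST C ⊓ ((ST C).liftAt 1 0 ⟹ Term.bdEqual (&0) &1).all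
  | .iotaG C D =>
      ((ST C).liftAt 1 0 ⊓ ((ST C).liftAt 2 0 ⟹ Term.bdEqual (&2) &1).all ⊓
        (ST D).liftAt 1 0).ex

/-- Lifting a formula in one variable past `n` outer variables amounts to evaluating it
at the last variable. -/
theorem realize_liftAt_zero_one {L : Language} {M : Type*} [L.Structure M] {α : Type*}
    {φ : L.BoundedFormula α 1} {n : ℕ} (hn : n ≤ 2) {v : α → M} {xs : Fin (1 + n) → M} :
    (φ.liftAt n 0).Realize v xs ↔ φ.Realize v fun _ => xs (Fin.addNat 0 n) := by
  rw [BoundedFormula.realize_liftAt (by omega)]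
  refine iff_of_eq (congrArg _ (funext fun i => ?_))
  simp [Subsingleton.elim i 0]

/-- for every interpretation `I`, `d ∈ Δ^I` and ALCι concept
`C`: `d ∈ C^I` iff `I ⊨ ST_x(C)[x ↦ d]`. -/
theorem stmt17 {D : Type u} [Nonempty D] (I : Interp D) (d : D) (C : Concept) :
    letI : ddLang.Structure D := I.toStructure
    (d ∈ I.sem C ↔ (ST C).Realize (fun e => e.elim) (fun _ => d)) := by
  letI : ddLang.Structure D := I.toStructure
  change d ∈ I.sem C ↔ (ST C).Realize (fun e => e.elim) (fun _ => d)
  induction C generalizing d with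
  | atom A => exact Iff.rfl
  | neg C ih => exact (not_congr (ih d))
  | conj C D' ihC ihD =>
    rw [ST, BoundedFormula.realize_inf, ← ihC, ← ihD]; rfl
  | ex r C ih =>
    rw [ST, BoundedFormula.realize_ex]
    refine exists_congr fun e => ?_
    rw [BoundedFormula.realize_inf, realize_liftAt_zero_one (by omega)]
    exact and_congr Iff.rfl (ih e)
  | iotaL C ih =>
    rw [ST, BoundedFormula.realize_inf, BoundedFormula.realize_all, ← ih]
    refine Set.eq_singleton_iff_unique_mem.trans (and_congr_right fun _ => forall_congr' fun e => ?_)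
    rw [BoundedFormula.realize_imp, realize_liftAt_zero_one (by omega),
      BoundedFormula.realize_bdEqual]
    exact imp_congr (ih e) eq_comm
  | iotaG C D' ihC ihD =>
    rw [ST, BoundedFormula.realize_ex]
    refine exists_congr fun e => ?_
    rw [BoundedFormula.realize_inf, BoundedFormula.realize_inf, BoundedFormula.realize_all,
      realize_liftAt_zero_one (by omega), realize_liftAt_zero_one (by omega)]
    refine and_congr (Set.eq_singleton_iff_unique_mem.trans
      (and_congr (ihC e) (forall_congr' fun a => ?_))) (ihD e)
    rw [BoundedFormula.realize_imp, realize_liftAt_zero_one le_rfl,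
      BoundedFormula.realize_bdEqual]
    exact imp_congr (ihC a) Iff.rfl

end DL
end
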